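/- Let ℓ > 0, Q^ℓ = [0, ℓ]², and let ρ : Q^ℓ → ℝ be Lipschitz continuous with ρ(x) ≥ a > 0, and set r(x) = ρ(x)/∫_{Q^ℓ} ρ, r₂(x₂) = ∫_0^ℓ r(x₁', x₂) dx₁'. Define G : Q^ℓ → ℝ² by G₁(x₁, x₂) = ℓ · (1/r₂(x₂)) ∫_0^{x₁} r(x₁', x₂) dx₁' and G₂(x₁, x₂) = ℓ · ∫_0^{x₂} r₂(x₂') dx₂'. Then G is a bijection of Q^ℓ onto Q^ℓ, and the pushforward under G of the probability measure ν with density r equals the uniform probability measure σ^ℓ on Q^ℓ (density ℓ^{-2}); equivalently, the inverse map Γ = G^{-1} transports σ^ℓ to ν, i.e. the pushforward of σ^ℓ under Γ is ν. -/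

import Mathlib

open MeasureTheory Filter
open scoped ENNReal NNReal Topology

noncomputable section

/-- The plane, with the Euclidean norm. -/
abbrev E2 : Type := EuclideanSpace ℝ (Fin 2)

/-- The point of `ℝ²` with coordinates `(s, t)`. -/
def mk2 (s t : ℝ) : E2 := (WithLp.equiv 2 (Fin 2 → ℝ)).symm ![s, t]

/-- The square `Q^ℓ = [0,ℓ]²`. -/
def sqSet (ℓ : ℝ) : Set E2 := {x | ∀ i, x i ∈ Set.Icc (0 : ℝ) ℓ}

lemma one_dim (ℓ : ℝ) (hℓ : 0 < ℓ) (g : ℝ → ℝ) (hg : Continuous g) (hp : ∀ s, 0 < g s)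
    (M : ℝ) (hM : M = ∫ s in (0:ℝ)..ℓ, g s) (F : ℝ → ℝ)
    (hF : F = fun s => ℓ * M⁻¹ * ∫ u in (0:ℝ)..s, g u) :
    0 < M ∧ Set.BijOn F (Set.Icc 0 ℓ) (Set.Icc 0 ℓ) ∧
    ∀ φ : ℝ → ℝ≥0∞, ∫⁻ s in Set.Icc 0 ℓ, φ (F s) * ENNReal.ofReal (g s)
      = ENNReal.ofReal (M / ℓ) * ∫⁻ s in Set.Icc 0 ℓ, φ s := by
  have hMp : 0 < M := by
    rw [hM]
    exact intervalIntegral.intervalIntegral_pos_of_pos (hg.intervalIntegrable _ _) hp hℓ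
  have hd : ∀ s, HasDerivAt F (ℓ * M⁻¹ * g s) s := by
    intro s
    rw [hF]
    exact (intervalIntegral.integral_hasDerivAt_right (hg.intervalIntegrable _ _)
      hg.stronglyMeasurable.stronglyMeasurableAtFilter hg.continuousAt).const_mul _
  have hmono : StrictMono F := by
    apply strictMono_of_hasDerivAt_pos hd
    intro s
    have := hp s
    positivity
  have hcont : Continuous F := continuous_iff_continuousAt.2 fun s => (hd s).continuousAt
  have h0 : F 0 = 0 := by simp [hF]
  have h1 : F ℓ = ℓ := by simp only [hF]; rw [← hM]; field_simp
  have hbij : Set.BijOn F (Set.Icc 0 ℓ) (Set.Icc 0 ℓ) := by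
    refine ⟨?_, hmono.injective.injOn, ?_⟩
    · intro s hs
      exact ⟨h0 ▸ hmono.monotone hs.1, h1 ▸ hmono.monotone hs.2⟩
    · have := intermediate_value_Icc hℓ.le hcont.continuousOn
      rwa [h0, h1] at this
  refine ⟨hMp, hbij, fun φ => ?_⟩
  have key := lintegral_image_eq_lintegral_abs_deriv_mul (measurableSet_Icc (a := (0:ℝ)) (b := ℓ))
    (fun s _ => (hd s).hasDerivWithinAt) hmono.injective.injOn φ
  rw [hbij.image_eq] at key
  rw [key, ← lintegral_const_mul']
  · refine lintegral_congr fun s => ?_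
    have := hp s
    rw [← mul_assoc, ← ENNReal.ofReal_mul (by positivity), mul_comm]
    congr 2
    rw [abs_of_pos (by positivity)]
    field_simp
  · exact ENNReal.ofReal_ne_top

/-- Coordinates as a measurable equivalence. -/
def eqv : ℝ × ℝ ≃ᵐ E2 :=
  (MeasurableEquiv.finTwoArrow (α := ℝ)).symm.trans (MeasurableEquiv.toLp 2 (Fin 2 → ℝ))

lemma eqv_apply (p : ℝ × ℝ) : eqv p = mk2 p.1 p.2 := by
  rfl

lemma eqv_mp : MeasurePreserving eqv (volume : Measure (ℝ × ℝ)) (volume : Measure E2) := by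
  unfold eqv
  exact (EuclideanSpace.volume_preserving_symm_measurableEquiv_toLp (Fin 2)).symm.comp
    (volume_preserving_finTwoArrow ℝ).symm

lemma mk2_zero (s t : ℝ) : mk2 s t 0 = s := rfl
lemma mk2_one (s t : ℝ) : mk2 s t 1 = t := rfl
lemma mk2_eta (x : E2) : mk2 (x 0) (x 1) = x := by
  ext i; fin_cases i <;> rfl
lemma mk2_cont : Continuous fun p : ℝ × ℝ => mk2 p.1 p.2 := by
  unfold mk2
  refine (PiLp.continuous_toLp 2 _).comp ?_
  refine continuous_pi fun i => ?_
  fin_cases i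
  · exact continuous_fst
  · exact continuous_snd
lemma mk2_mem (ℓ s t : ℝ) : mk2 s t ∈ sqSet ℓ ↔ s ∈ Set.Icc 0 ℓ ∧ t ∈ Set.Icc 0 ℓ := by
  unfold sqSet
  simp only [Set.mem_ofPred_eq, Fin.forall_fin_two, mk2_zero, mk2_one]
lemma eqv_pre (ℓ : ℝ) : eqv ⁻¹' (sqSet ℓ) = Set.Icc 0 ℓ ×ˢ Set.Icc 0 ℓ := by
  ext p
  simp only [Set.mem_preimage, eqv_apply, mk2_mem, Set.mem_prod]
lemma sq_closed (ℓ : ℝ) : IsClosed (sqSet ℓ) := by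
  have : sqSet ℓ = ⋂ i, (fun x : E2 => x i) ⁻¹' (Set.Icc 0 ℓ) := by
    ext x; simp [sqSet]
  rw [this]
  exact isClosed_iInter fun i => isClosed_Icc.preimage (by fun_prop)

lemma two_dim (ℓ : ℝ) (hℓ : 0 < ℓ) (f : ℝ → ℝ → ℝ)
    (hf : Continuous fun p : ℝ × ℝ => f p.1 p.2) (hp : ∀ s t, 0 < f s t)
    (R : ℝ → ℝ) (hR : R = fun t => ∫ s in (0:ℝ)..ℓ, f s t)
    (hR1 : ∫ t in (0:ℝ)..ℓ, R t = 1) (g : ℝ × ℝ → ℝ × ℝ)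
    (hg : g = fun p => (ℓ * (R p.2)⁻¹ * ∫ u in (0:ℝ)..p.1, f u p.2,
      ℓ * ∫ t in (0:ℝ)..p.2, R t)) :
    Continuous g ∧ Set.BijOn g (Set.Icc 0 ℓ ×ˢ Set.Icc 0 ℓ) (Set.Icc 0 ℓ ×ˢ Set.Icc 0 ℓ) ∧
    ∀ φ : ℝ × ℝ → ℝ≥0∞, Measurable φ →
      ∫⁻ p in Set.Icc 0 ℓ ×ˢ Set.Icc 0 ℓ, φ (g p) * ENNReal.ofReal (f p.1 p.2)
        = ENNReal.ofReal (ℓ ^ 2)⁻¹ * ∫⁻ p in Set.Icc 0 ℓ ×ˢ Set.Icc 0 ℓ, φ p := by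
  have hft : ∀ t, Continuous fun s => f s t := fun t =>
    hf.comp (continuous_id.prodMk continuous_const)
  have h1 := fun t => one_dim ℓ hℓ (fun s => f s t) (hft t) (fun s => hp s t) (R t)
    (by rw [hR]) (fun s => ℓ * (R t)⁻¹ * ∫ u in (0:ℝ)..s, f u t) rfl
  have hRc : Continuous R := by
    rw [hR]
    exact intervalIntegral.continuous_parametric_intervalIntegral_of_continuous
      (f := fun t s => f s t) (hf.comp continuous_swap) continuous_const
  have h2 := one_dim ℓ hℓ R hRc (fun t => (h1 t).1) 1 hR1.symm
    (fun t => ℓ * ∫ u in (0:ℝ)..t, R u) (by simp)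
  have hgc : Continuous g := by
    rw [hg]
    refine Continuous.prodMk ?_ ?_
    · refine (continuous_const.mul ((hRc.comp continuous_snd).inv₀ fun p => (h1 p.2).1.ne')).mul ?_
      exact intervalIntegral.continuous_parametric_intervalIntegral_of_continuous
        (f := fun (p : ℝ × ℝ) u => f u p.2)
        (hf.comp (continuous_snd.prodMk (continuous_snd.comp continuous_fst))) continuous_fst
    · refine continuous_const.mul ?_
      exact intervalIntegral.continuous_parametric_intervalIntegral_of_continuous
        (f := fun (p : ℝ × ℝ) u => R u) (hRc.comp continuous_snd) continuous_snd
  refine ⟨hgc, ⟨?_, ?_, ?_⟩, ?_⟩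
  · rintro ⟨s, t⟩ ⟨hs, ht⟩
    rw [hg]
    exact ⟨(h1 t).2.1.mapsTo hs, h2.2.1.mapsTo ht⟩
  · rintro ⟨s, t⟩ ⟨hs, ht⟩ ⟨s', t'⟩ ⟨hs', ht'⟩ h
    rw [hg] at h
    have htt : t = t' := h2.2.1.injOn ht ht' (congrArg Prod.snd h)
    subst htt
    have hss : s = s' := (h1 t).2.1.injOn hs hs' (congrArg Prod.fst h)
    rw [hss]
  · rintro ⟨x, y⟩ ⟨hx, hy⟩
    obtain ⟨t, ht, hty⟩ := h2.2.1.surjOn hy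
    obtain ⟨s, hs, hsx⟩ := (h1 t).2.1.surjOn hx
    refine ⟨(s, t), ⟨hs, ht⟩, ?_⟩
    rw [hg]
    exact Prod.ext hsx hty
  · intro φ hφ
    rw [Measure.volume_eq_prod, ← Measure.prod_restrict,
      lintegral_prod_symm (fun p => φ (g p) * ENNReal.ofReal (f p.1 p.2))
        ((hφ.comp hgc.measurable).mul hf.measurable.ennreal_ofReal).aemeasurable,
      lintegral_prod_symm _ hφ.aemeasurable]
    have e1 : ∀ t, ∫⁻ s in Set.Icc 0 ℓ, φ (g (s, t)) * ENNReal.ofReal (f s t)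
        = ENNReal.ofReal ℓ⁻¹ * ((∫⁻ s in Set.Icc 0 ℓ, φ (s, ℓ * ∫ u in (0:ℝ)..t, R u))
          * ENNReal.ofReal (R t)) := by
      intro t
      have := (h1 t).2.2 (fun s => φ (s, ℓ * ∫ u in (0:ℝ)..t, R u))
      simp only [hg]
      rw [this, div_eq_mul_inv, ENNReal.ofReal_mul (h1 t).1.le]
      ring
    simp only [e1]
    rw [lintegral_const_mul' _ _ ENNReal.ofReal_ne_top,
      h2.2.2 (fun y => ∫⁻ s in Set.Icc 0 ℓ, φ (s, y)), ← mul_assoc,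
      ← ENNReal.ofReal_mul (by positivity)]
    congr 2
    field_simp

theorem transport_map_of_density
    (ℓ : ℝ) (hℓ : 0 < ℓ) (ρ : E2 → ℝ)
    (hlip : ∃ K : ℝ≥0, LipschitzOnWith K ρ (sqSet ℓ))
    (a : ℝ) (ha : 0 < a) (hpos : ∀ x ∈ sqSet ℓ, a ≤ ρ x)
    (r : E2 → ℝ) (hr : r = fun x => ρ x / ∫ y in sqSet ℓ, ρ y)
    (r₂ : ℝ → ℝ)
    (hr₂ : r₂ = fun x₂ => ∫ x₁' in Set.Icc (0 : ℝ) ℓ, r (mk2 x₁' x₂))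
    (G : E2 → E2)
    (hG : G = fun x => mk2
      (ℓ * (r₂ (x 1))⁻¹ * ∫ s in (0 : ℝ)..(x 0), r (mk2 s (x 1)))
      (ℓ * ∫ t in (0 : ℝ)..(x 1), r₂ t))
    (ν σℓ : Measure E2)
    (hν : ν = (volume.restrict (sqSet ℓ)).withDensity
        (fun x => ENNReal.ofReal (r x)))
    (hσ : σℓ = (volume.restrict (sqSet ℓ)).withDensity
        (fun _ => ENNReal.ofReal (ℓ ^ 2)⁻¹)) :
    Set.BijOn G (sqSet ℓ) (sqSet ℓ) ∧
    Measure.map G ν = σℓ ∧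
    ∀ Γ : E2 → E2, Set.InvOn Γ G (sqSet ℓ) (sqSet ℓ) →
      Measure.map Γ σℓ = ν := by

  obtain ⟨K, hlip⟩ := hlip
  have hme : MeasurableSet (sqSet ℓ) := (sq_closed ℓ).measurableSet
  set Q : Set (ℝ × ℝ) := Set.Icc 0 ℓ ×ˢ Set.Icc 0 ℓ with hQ
  have hcl : ∀ s : ℝ, max 0 (min s ℓ) ∈ Set.Icc 0 ℓ := fun s =>
    ⟨le_max_left _ _, max_le hℓ.le (min_le_right _ _)⟩
  have hcl' : ∀ s ∈ Set.Icc 0 ℓ, max 0 (min s ℓ) = s := fun s hs => by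
    rw [min_eq_left hs.2, max_eq_right hs.1]
  -- extended density
  let f₀ : ℝ → ℝ → ℝ := fun s t => ρ (mk2 (max 0 (min s ℓ)) (max 0 (min t ℓ)))
  have hf₀ : Continuous fun p : ℝ × ℝ => f₀ p.1 p.2 := by
    refine hlip.continuousOn.comp_continuous (f := fun p : ℝ × ℝ =>
      mk2 (max 0 (min p.1 ℓ)) (max 0 (min p.2 ℓ))) ?_ ?_
    · exact mk2_cont.comp (f := fun p : ℝ × ℝ => ((max 0 (min p.1 ℓ)), (max 0 (min p.2 ℓ))))
        (by fun_prop)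
    · intro p
      rw [mk2_mem]
      exact ⟨hcl _, hcl _⟩
  have hf₀p : ∀ s t, 0 < f₀ s t := fun s t =>
    ha.trans_le (hpos _ ((mk2_mem _ _ _).2 ⟨hcl _, hcl _⟩))
  have hf₀e : ∀ s ∈ Set.Icc 0 ℓ, ∀ t ∈ Set.Icc 0 ℓ, f₀ s t = ρ (mk2 s t) := by
    intro s hs t ht
    simp only [f₀, hcl' s hs, hcl' t ht]
  obtain ⟨I, hI⟩ : ∃ I, I = ∫ y in sqSet ℓ, ρ y := ⟨_, rfl⟩
  rw [← hI] at hr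
  have hI2 : I = ∫ t in (0:ℝ)..ℓ, ∫ s in (0:ℝ)..ℓ, f₀ s t := by
    rw [hI, ← eqv_mp.setIntegral_preimage_emb eqv.measurableEmbedding, eqv_pre]
    have : ∫ p in Q, ρ (eqv p) = ∫ p in Q, f₀ p.1 p.2 := by
      refine setIntegral_congr_fun (measurableSet_Icc.prod measurableSet_Icc) ?_
      rintro ⟨s, t⟩ ⟨hs, ht⟩
      exact (hf₀e s hs t ht).symm
    rw [← hQ, this, hQ, Measure.volume_eq_prod, ← Measure.prod_restrict, integral_prod_symm]
    · rw [intervalIntegral.integral_of_le hℓ.le, ← integral_Icc_eq_integral_Ioc]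
      simp only [intervalIntegral.integral_of_le hℓ.le, ← integral_Icc_eq_integral_Ioc]
    · rw [Measure.prod_restrict]
      exact hf₀.continuousOn.integrableOn_compact (isCompact_Icc.prod isCompact_Icc)
  have hRc₀ : Continuous fun t => ∫ s in (0:ℝ)..ℓ, f₀ s t :=
    intervalIntegral.continuous_parametric_intervalIntegral_of_continuous
      (f := fun t s => f₀ s t) (hf₀.comp continuous_swap) continuous_const
  have hIp : 0 < I := by
    rw [hI2]
    refine intervalIntegral.intervalIntegral_pos_of_pos (hRc₀.intervalIntegrable _ _)
      (fun t => ?_) hℓ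
    exact intervalIntegral.intervalIntegral_pos_of_pos
      ((hf₀.comp (continuous_id.prodMk continuous_const)).intervalIntegrable _ _)
      (fun s => hf₀p s t) hℓ
  let f : ℝ → ℝ → ℝ := fun s t => f₀ s t / I
  let R : ℝ → ℝ := fun t => ∫ s in (0:ℝ)..ℓ, f s t
  let g : ℝ × ℝ → ℝ × ℝ := fun p => (ℓ * (R p.2)⁻¹ * ∫ u in (0:ℝ)..p.1, f u p.2,
      ℓ * ∫ t in (0:ℝ)..p.2, R t)
  have hfe : ∀ s ∈ Set.Icc 0 ℓ, ∀ t ∈ Set.Icc 0 ℓ, f s t = r (mk2 s t) := by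
    intro s hs t ht
    simp only [f, hr, hf₀e s hs t ht]
  obtain ⟨hgc, hgb, hgi⟩ := two_dim ℓ hℓ f (hf₀.div_const I) (fun s t => div_pos (hf₀p s t) hIp)
    R rfl (by
      simp only [R, f, intervalIntegral.integral_div]
      rw [← hI2, div_self hIp.ne']) g rfl
  have hRe : ∀ t ∈ Set.Icc 0 ℓ, r₂ t = R t := by
    intro t ht
    simp only [hr₂, R]
    rw [intervalIntegral.integral_of_le hℓ.le, ← integral_Icc_eq_integral_Ioc]
    exact setIntegral_congr_fun measurableSet_Icc fun s hs => (hfe s hs t ht).symm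
  have hGe : ∀ s ∈ Set.Icc 0 ℓ, ∀ t ∈ Set.Icc 0 ℓ, G (mk2 s t) = eqv (g (s, t)) := by
    intro s hs t ht
    simp only [hG, g, eqv_apply, mk2_zero, mk2_one]
    rw [hRe t ht]
    congr 2
    · refine intervalIntegral.integral_congr fun u hu => ?_
      rw [Set.uIcc_of_le hs.1] at hu
      exact (hfe u ⟨hu.1, hu.2.trans hs.2⟩ t ht).symm
    · refine intervalIntegral.integral_congr fun u hu => ?_
      rw [Set.uIcc_of_le ht.1] at hu
      exact hRe u ⟨hu.1, hu.2.trans ht.2⟩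
  have hmem : ∀ x, x ∈ sqSet ℓ ↔ (x 0, x 1) ∈ Q := by
    intro x
    conv_lhs => rw [← mk2_eta x, mk2_mem]
    rfl
  have hGe' : ∀ x ∈ sqSet ℓ, G x = eqv (g (x 0, x 1)) := by
    intro x hx
    have := (hmem x).1 hx
    rw [← hGe _ this.1 _ this.2, mk2_eta]
  have hGc' : Continuous fun x : E2 => eqv (g (x 0, x 1)) := by
    refine mk2_cont.comp (hgc.comp (f := fun x : E2 => (x 0, x 1)) ?_)
    fun_prop
  have hGcon : ContinuousOn G (sqSet ℓ) := hGc'.continuousOn.congr hGe'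
  have hbij : Set.BijOn G (sqSet ℓ) (sqSet ℓ) := by
    refine ⟨?_, ?_, ?_⟩
    · intro x hx
      rw [hGe' x hx, eqv_apply, mk2_mem]
      exact hgb.mapsTo ((hmem x).1 hx)
    · intro x hx y hy h
      rw [hGe' x hx, hGe' y hy] at h
      have h2 := hgb.injOn ((hmem x).1 hx) ((hmem y).1 hy) (eqv.injective h)
      have h3 : x 0 = y 0 := congrArg Prod.fst h2
      have h4 : x 1 = y 1 := congrArg Prod.snd h2
      rw [← mk2_eta x, ← mk2_eta y, h3, h4]
    · intro y hy
      obtain ⟨p, hp, hpy⟩ := hgb.surjOn ((hmem y).1 hy)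
      refine ⟨mk2 p.1 p.2, (mk2_mem _ _ _).2 hp, ?_⟩
      rw [hGe _ hp.1 _ hp.2, Prod.mk.eta, hpy, eqv_apply, mk2_eta]
  have hac : ν ≪ volume.restrict (sqSet ℓ) := hν ▸ withDensity_absolutelyContinuous _ _
  have hGae : G =ᵐ[ν] fun x : E2 => eqv (g (x 0, x 1)) :=
    hac.ae_le (ae_restrict_of_forall_mem hme hGe')
  have hmap : Measure.map G ν = σℓ := by
    rw [Measure.map_congr hGae, hσ]
    ext A hA
    rw [Measure.map_apply hGc'.measurable hA, hν,
      withDensity_apply _ (hGc'.measurable hA), withDensity_apply _ hA,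
      ← lintegral_indicator (hGc'.measurable hA), ← lintegral_indicator hA,
      ← eqv_mp.setLIntegral_comp_preimage_emb eqv.measurableEmbedding,
      ← eqv_mp.setLIntegral_comp_preimage_emb eqv.measurableEmbedding, eqv_pre]
    have hA' : MeasurableSet (eqv ⁻¹' A) := eqv.measurable hA
    have key := hgi ((eqv ⁻¹' A).indicator 1) (measurable_one.indicator hA')
    rw [← lintegral_const_mul' _ _ ENNReal.ofReal_ne_top] at key
    convert key using 1
    · refine setLIntegral_congr_fun (measurableSet_Icc.prod measurableSet_Icc) ?_
      rintro ⟨s, t⟩ ⟨hs, ht⟩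
      have hrf : f s t = r (eqv (s, t)) := hfe s hs t ht
      have hm : eqv (s, t) ∈ (fun x : E2 => eqv (g (x 0, x 1))) ⁻¹' A ↔
        g (s, t) ∈ eqv ⁻¹' A := Iff.rfl
      simp only [hrf]
      by_cases h : g (s, t) ∈ eqv ⁻¹' A
      · rw [Set.indicator_of_mem (hm.2 h), Set.indicator_of_mem h, Pi.one_apply, one_mul]
      · rw [Set.indicator_of_notMem (fun h' => h (hm.1 h')), Set.indicator_of_notMem h, zero_mul]
    · refine lintegral_congr fun p => ?_
      by_cases h : eqv p ∈ A
      · rw [Set.indicator_of_mem h, Set.indicator_of_mem (show p ∈ eqv ⁻¹' A from h),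
          Pi.one_apply, mul_one]
      · rw [Set.indicator_of_notMem h, Set.indicator_of_notMem (show p ∉ eqv ⁻¹' A from h),
          mul_zero]
  refine ⟨hbij, hmap, fun Γ hΓ => ?_⟩
  have hΓm : AEMeasurable Γ σℓ := by
    have hcs : CompleteSpace (sqSet ℓ) := (sq_closed ℓ).completeSpace_coe
    have hemb : MeasurableEmbedding (fun x : sqSet ℓ => G x) :=
      Continuous.measurableEmbedding hGcon.domRestrict
        (fun x y h => Subtype.ext (hbij.injOn x.2 y.2 h))
    refine ⟨Function.extend (fun x : sqSet ℓ => G x) (fun x => (x : E2)) (fun _ => 0),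
      hemb.measurable_extend measurable_subtype_coe measurable_const, ?_⟩
    have hac' : σℓ ≪ volume.restrict (sqSet ℓ) := hσ ▸ withDensity_absolutelyContinuous _ _
    refine hac'.ae_le (ae_restrict_of_forall_mem hme ?_)
    intro y hy
    obtain ⟨x, hx, rfl⟩ := hbij.surjOn hy
    rw [hΓ.1 hx]
    exact (hemb.injective.extend_apply (fun x : sqSet ℓ => (x : E2)) (fun _ => 0)
      (⟨x, hx⟩ : sqSet ℓ)).symm
  have hGm : AEMeasurable G ν := ⟨_, hGc'.measurable, hGae⟩
  rw [← hmap] at hΓm ⊢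
  rw [AEMeasurable.map_map_of_aemeasurable hΓm hGm]
  have : Γ ∘ G =ᵐ[ν] id := hac.ae_le (ae_restrict_of_forall_mem hme fun x hx => hΓ.1 hx)
  rw [Measure.map_congr this, Measure.map_id]
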